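/- arXiv:1408.1815 — 3 statements merged into one kernel-verified Lean document; each statement's English description precedes it below -/
import Mathlib

section
/- Let d ≥ 1. There exists a free measure preserving ℤ^d-action T on a σ-finite standard measure space (X, μ) with μ(X) = ∞ such that T is recurrent along every line, i.e. 𝓡(T) = P(ℝ^d). -/
open MeasureTheory Filter Set Topology

noncomputable section

instance {d : ℕ} : TopologicalSpace (Projectivization ℝ (Fin d → ℝ)) :=
  inferInstanceAs (TopologicalSpace (Quotient _))

/-- The coordinatewise cast of an integer vector to a real vector. -/
def zcast {d : ℕ} (γ : Fin d → ℤ) : Fin d → ℝ := fun i => (γ i : ℝ)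

/-- `T` is a measure preserving `ℤ^d`-action on `(X, μ)`. -/
def IsMPAction {d : ℕ} {X : Type*} [MeasurableSpace X] (μ : Measure X)
    (T : (Fin d → ℤ) → X ≃ᵐ X) : Prop :=
  (∀ γ γ' : Fin d → ℤ, ∀ x : X, T (γ + γ') x = T γ (T γ' x)) ∧
    ∀ γ : Fin d → ℤ, MeasurePreserving (T γ) μ μ

/-- The action `T` is free. -/
def IsFreeAction {d : ℕ} {X : Type*} [MeasurableSpace X] (μ : Measure X)
    (T : (Fin d → ℤ) → X ≃ᵐ X) : Prop :=
  ∀ γ : Fin d → ℤ, γ ≠ 0 → ∀ᵐ x ∂μ, T γ x ≠ x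

/-- `T` is recurrent along the line `θ ∈ P(ℝ^d)`. -/
def RecurrentAlong {d : ℕ} {X : Type*} [MeasurableSpace X] (μ : Measure X)
    (T : (Fin d → ℤ) → X ≃ᵐ X) (θ : Projectivization ℝ (Fin d → ℝ)) : Prop :=
  ∀ ε : ℝ, 0 < ε → ∀ A : Set X, MeasurableSet A → 0 < μ A →
    ∃ γ : Fin d → ℤ, γ ≠ 0 ∧ ∃ v ∈ θ.submodule, ‖zcast γ - v‖ < ε ∧ 0 < μ (A ∩ T γ '' A)

/-- The set of recurrent directions `𝓡(T)`. -/
def recSet {d : ℕ} {X : Type*} [MeasurableSpace X] (μ : Measure X)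
    (T : (Fin d → ℤ) → X ≃ᵐ X) : Set (Projectivization ℝ (Fin d → ℝ)) :=
  {θ | RecurrentAlong μ T θ}

/-- `T` is rigid along the line `θ ∈ P(ℝ^d)`. -/
def RigidAlong {d : ℕ} {X : Type*} [MeasurableSpace X] (μ : Measure X)
    (T : (Fin d → ℤ) → X ≃ᵐ X) (θ : Projectivization ℝ (Fin d → ℝ)) : Prop :=
  ∃ γ : ℕ → Fin d → ℤ,
    Tendsto (fun n => ‖zcast (γ n)‖) atTop atTop ∧
    Tendsto (fun n => Metric.infDist (zcast (γ n)) ((θ.submodule : Set (Fin d → ℝ)))) atTop (𝓝 0) ∧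
    ∀ A : Set X, MeasurableSet A → μ A < ⊤ →
      Tendsto (fun n => μ (A ∩ T (γ n) '' A)) atTop (𝓝 (μ A))

/-- The set of rigid directions `𝓡i(T)`. -/
def rigSet {d : ℕ} {X : Type*} [MeasurableSpace X] (μ : Measure X)
    (T : (Fin d → ℤ) → X ≃ᵐ X) : Set (Projectivization ℝ (Fin d → ℝ)) :=
  {θ | RigidAlong μ T θ}

/-- The measure `Leb × μ` on `[0,1)^d × X`. -/
def indMeasure {d : ℕ} {X : Type*} [MeasurableSpace X] (μ : Measure X) :
    Measure ((Fin d → ℝ) × X) :=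
  (Measure.pi fun _ : Fin d => (volume : Measure ℝ).restrict (Set.Ico 0 1)).prod μ

/-- The induced `ℝ^d`-action `T̃_t(y, x) = ({t+y}, T_{[t+y]} x)`. -/
def indMap {d : ℕ} {X : Type*} [MeasurableSpace X] (T : (Fin d → ℤ) → X ≃ᵐ X)
    (t : Fin d → ℝ) : (Fin d → ℝ) × X → (Fin d → ℝ) × X :=
  fun p => (fun i => Int.fract (t i + p.1 i), T (fun i => ⌊t i + p.1 i⌋) p.2)

/-- A one-parameter flow `F` on `(Y, ν)` is conservative. -/
def FlowConservative {Y : Type*} [MeasurableSpace Y] (ν : Measure Y) (F : ℝ → Y → Y) : Prop :=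
  ∀ B : Set Y, MeasurableSet B → 0 < ν B → ∀ K : Set ℝ, IsCompact K →
    ∃ s : ℝ, s ∉ K ∧ 0 < ν (B ∩ F s '' B)

/-- A one-parameter flow `F` on `(Y, ν)` is rigid. -/
def FlowRigid {Y : Type*} [MeasurableSpace Y] (ν : Measure Y) (F : ℝ → Y → Y) : Prop :=
  ∃ s : ℕ → ℝ, Tendsto s atTop atTop ∧
    ∀ B : Set Y, MeasurableSet B → ν B < ⊤ →
      Tendsto (fun n => ν (B ∩ F (s n) '' B)) atTop (𝓝 (ν B))

/-- An `ℝ^d`-action `R` on `(Y, ν)` is recurrent along the line `θ`: the flow along some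
(equivalently, every) nonzero vector of `θ` is conservative. -/
def ActionRecurrentAlong {d : ℕ} {Y : Type*} [MeasurableSpace Y] (ν : Measure Y)
    (R : (Fin d → ℝ) → Y → Y) (θ : Projectivization ℝ (Fin d → ℝ)) : Prop :=
  ∃ v ∈ θ.submodule, v ≠ (0 : Fin d → ℝ) ∧ FlowConservative ν (fun s => R (s • v))

/-- An `ℝ^d`-action `R` on `(Y, ν)` is rigid along the line `θ`. -/
def ActionRigidAlong {d : ℕ} {Y : Type*} [MeasurableSpace Y] (ν : Measure Y)
    (R : (Fin d → ℝ) → Y → Y) (θ : Projectivization ℝ (Fin d → ℝ)) : Prop :=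
  ∃ v ∈ θ.submodule, v ≠ (0 : Fin d → ℝ) ∧ FlowRigid ν (fun s => R (s • v))

/-- Infinitely many integer times of the flow `n ↦ n • v` have nearly equal fractional parts:
the integer parts along such times form a sequence of lattice points whose differences
are close to the line spanned by `v`. -/
lemma exists_strictMono_floor_sub_near {d : ℕ} (v : Fin d → ℝ) {ε : ℝ} (hε : 0 < ε) :
    ∃ φ : ℕ → ℕ, StrictMono φ ∧ ∀ m n : ℕ,
      ‖zcast ((fun i => ⌊(φ m : ℝ) * v i⌋) - fun i => ⌊(φ n : ℝ) * v i⌋)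
        - ((φ m : ℝ) - φ n) • v‖ < ε := by
  let f : ℕ → Fin d → ℝ := fun n i => Int.fract ((n : ℝ) * v i)
  have hf : ∀ n, f n ∈ Icc (0 : Fin d → ℝ) 1 := fun n =>
    ⟨fun i => Int.fract_nonneg _, fun i => (Int.fract_lt_one _).le⟩
  obtain ⟨a, -, φ, hφ, ha⟩ := tendsto_subseq_of_bounded (Metric.isBounded_Icc _ _) hf
  obtain ⟨K, hK⟩ := Metric.tendsto_atTop.1 ha (ε / 2) (half_pos hε)
  refine ⟨fun k => φ (k + K), fun a b hab => hφ (by omega), fun m n => ?_⟩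
  have h : dist (f (φ (n + K))) (f (φ (m + K))) < ε := by
    have h1 := hK (n + K) (by omega)
    have h2 := hK (m + K) (by omega)
    have h3 := dist_triangle_right (f (φ (n + K))) (f (φ (m + K))) a
    simp only [Function.comp_apply] at h1 h2
    linarith
  rw [dist_eq_norm] at h
  refine lt_of_eq_of_lt (congrArg norm ?_) h
  ext i
  simp only [zcast, f, Int.fract, Pi.sub_apply, Pi.smul_apply, smul_eq_mul, Int.cast_sub]
  ring

/-- Pigeonhole principle: a sequence of sets of equal positive measure inside a set of finite
measure contains two sets that meet in positive measure. -/
lemma exists_ne_measure_inter_pos {X : Type*} [MeasurableSpace X] {μ : Measure X}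
    {C : ℕ → Set X} {F : Set X} {c : ENNReal} (hC : ∀ n, MeasurableSet (C n))
    (hCF : ∀ n, C n ⊆ F) (hF : μ F ≠ ⊤) (hc : c ≠ 0) (hμ : ∀ n, μ (C n) = c) :
    ∃ m n, m ≠ n ∧ 0 < μ (C m ∩ C n) := by
  by_contra! h
  have hd : Pairwise (Function.onFun (AEDisjoint μ) C) :=
    fun m n hmn => le_antisymm (h m n hmn) zero_le
  have hU := measure_iUnion₀ hd fun n => (hC n).nullMeasurableSet
  simp only [hμ, ENNReal.tsum_const_eq_top_of_ne_zero hc] at hU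
  exact hF (top_le_iff.1 (hU ▸ measure_mono (iUnion_subset hCF)))

/-- Poincaré recurrence along a line, for sets inside an invariant set of finite measure. -/
lemma exists_return_near_line {d : ℕ} {X : Type*} [MeasurableSpace X] {μ : Measure X}
    {T : (Fin d → ℤ) → X ≃ᵐ X} (hT : IsMPAction μ T) {F B : Set X} (hF : μ F ≠ ⊤)
    (hTF : ∀ γ, T γ ⁻¹' F ⊆ F) (hB : MeasurableSet B) (hBF : B ⊆ F) (hB0 : 0 < μ B)
    (θ : Projectivization ℝ (Fin d → ℝ)) {ε : ℝ} (hε : 0 < ε) :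
    ∃ γ : Fin d → ℤ, γ ≠ 0 ∧ ∃ v ∈ θ.submodule,
      ‖zcast γ - v‖ < ε ∧ 0 < μ (B ∩ T γ '' B) := by
  obtain ⟨i, hi⟩ := Function.ne_iff.1 θ.rep_nonzero
  simp only [Pi.zero_apply] at hi
  set v : Fin d → ℝ := (θ.rep i)⁻¹ • θ.rep with hv
  have hvi : v i = 1 := by simp [hv, hi]
  have hvθ : v ∈ θ.submodule := by
    rw [Projectivization.submodule_eq]
    exact Submodule.smul_mem _ _ (Submodule.mem_span_singleton_self _)
  obtain ⟨φ, hφ, hnear⟩ := exists_strictMono_floor_sub_near v hε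
  set g : ℕ → Fin d → ℤ := fun n i => ⌊(φ n : ℝ) * v i⌋ with hg
  obtain ⟨m, n, hmn, hpos⟩ := exists_ne_measure_inter_pos (C := fun n => T (g n) ⁻¹' B)
    (fun n => (T (g n)).measurable hB) (fun n => (preimage_mono hBF).trans (hTF _)) hF hB0.ne'
    (fun n => (hT.2 (g n)).measure_preimage hB.nullMeasurableSet)
  refine ⟨g m - g n, fun h0 => ?_, _, Submodule.smul_mem _ _ hvθ, hnear m n, ?_⟩
  · have := congrFun h0 i
    simp only [hg, Pi.sub_apply, hvi, mul_one, Int.floor_natCast, Pi.zero_apply] at this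
    exact hmn (hφ.injective (by omega))
  · have himg : T (g m) ⁻¹' (B ∩ T (g m - g n) '' B) = T (g m) ⁻¹' B ∩ T (g n) ⁻¹' B := by
      ext x
      have hx : T (g m) x = T (g m - g n) (T (g n) x) := by rw [← hT.1, sub_add_cancel]
      simp only [mem_preimage, mem_inter_iff]
      nth_rewrite 2 [hx]
      rw [(T (g m - g n)).injective.mem_set_image]
    rwa [← (hT.2 (g m)).measure_preimage_equiv, himg]

/-- The translation vector by which `γ` acts on `ℝ × 𝕋^d`: trivial on the line and rotation by
`√2 γ` on the torus. -/
def rotationVector {d : ℕ} (γ : Fin d → ℤ) : ℝ × (Fin d → UnitAddCircle) :=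
  (0, fun i => γ i • ((√2 : ℝ) : UnitAddCircle))

lemma rotationVector_add {d : ℕ} (γ γ' : Fin d → ℤ) :
    rotationVector (γ + γ') = rotationVector γ + rotationVector γ' := by
  simp only [rotationVector, Prod.mk_add_mk, add_zero, Pi.add_apply, add_smul]
  rfl

lemma rotationVector_ne_zero {d : ℕ} {γ : Fin d → ℤ} (hγ : γ ≠ 0) : rotationVector γ ≠ 0 := by
  intro h
  obtain ⟨i, hi⟩ := Function.ne_iff.1 hγ
  have h1 : γ i • ((√2 : ℝ) : UnitAddCircle) = 0 := congrFun (congrArg Prod.snd h) i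
  rw [← AddCircle.coe_zsmul, AddCircle.coe_eq_zero_iff] at h1
  obtain ⟨n, hn⟩ := h1
  simp only [zsmul_eq_mul, mul_one] at hn
  exact (irrational_sqrt_two.intCast_mul hi).ne_int n hn.symm

/-- The `ℤ^d`-action on `ℝ × 𝕋^d` by the translations `rotationVector γ`. -/
def rotationAction {d : ℕ} (γ : Fin d → ℤ) :
    (ℝ × (Fin d → UnitAddCircle)) ≃ᵐ (ℝ × (Fin d → UnitAddCircle)) :=
  MeasurableEquiv.addLeft (rotationVector γ)

lemma isMPAction_rotationAction {d : ℕ} :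
    IsMPAction (volume : Measure (ℝ × (Fin d → UnitAddCircle))) rotationAction := by
  have : (volume : Measure (ℝ × (Fin d → UnitAddCircle))).IsAddLeftInvariant :=
    Measure.prod.instIsAddLeftInvariant
  refine ⟨fun γ γ' x => ?_, fun γ => measurePreserving_add_left _ _⟩
  simp [rotationAction, rotationVector_add, add_assoc]

lemma isFreeAction_rotationAction {d : ℕ} :
    IsFreeAction (volume : Measure (ℝ × (Fin d → UnitAddCircle))) rotationAction := by
  refine fun γ hγ => ae_of_all _ fun x hx => rotationVector_ne_zero hγ ?_
  simpa [rotationAction] using hx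

lemma recurrentAlong_rotationAction {d : ℕ} (θ : Projectivization ℝ (Fin d → ℝ)) :
    RecurrentAlong (volume : Measure (ℝ × (Fin d → UnitAddCircle))) rotationAction θ := by
  intro ε hε A hA hA0
  let F : ℕ → Set (ℝ × (Fin d → UnitAddCircle)) := fun k => Icc (-(k : ℝ)) k ×ˢ univ
  have hFm : ∀ k, MeasurableSet (F k) := fun k => measurableSet_Icc.prod MeasurableSet.univ
  have hAF : A = ⋃ k, A ∩ F k := by
    rw [← inter_iUnion, eq_comm, inter_eq_left]
    intro x _
    obtain ⟨k, hk⟩ := exists_nat_ge |x.1|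
    exact mem_iUnion.2 ⟨k, abs_le.1 hk, mem_univ _⟩
  obtain ⟨k, hk⟩ : ∃ k, 0 < volume (A ∩ F k) := by
    rw [hAF] at hA0
    exact exists_measure_pos_of_not_measure_iUnion_null hA0.ne'
  have hF : volume (F k) ≠ ⊤ := by
    rw [Measure.volume_eq_prod, Measure.prod_prod]
    exact ENNReal.mul_ne_top (by simp) (measure_ne_top _ _)
  obtain ⟨γ, hγ, v, hv, hγv, hpos⟩ := exists_return_near_line isMPAction_rotationAction hF
    (fun γ x hx => by simpa [F, rotationAction, rotationVector] using hx)
    (hA.inter (hFm k)) inter_subset_right hk θ hε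
  exact ⟨γ, hγ, v, hv, hγv, hpos.trans_le (measure_mono
    (inter_subset_inter inter_subset_left (image_mono inter_subset_left)))⟩

/-- there is a free infinite measure preserving `ℤ^d`-action which is recurrent
along every line: `𝓡(T) = P(ℝ^d)`. -/
theorem exists_action_recurrent_in_every_direction {d : ℕ} (hd : 1 ≤ d) :
    ∃ (X : Type) (_ : MeasurableSpace X), StandardBorelSpace X ∧
      ∃ μ : Measure X, SigmaFinite μ ∧ μ Set.univ = ⊤ ∧
        ∃ T : (Fin d → ℤ) → X ≃ᵐ X, IsMPAction μ T ∧ IsFreeAction μ T ∧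
          recSet μ T = Set.univ := by
  refine ⟨ℝ × (Fin d → UnitAddCircle), inferInstance, inferInstance, volume, inferInstance, ?_,
    rotationAction, isMPAction_rotationAction, isFreeAction_rotationAction,
    eq_univ_of_forall recurrentAlong_rotationAction⟩
  rw [Measure.volume_eq_prod, ← univ_prod_univ, Measure.prod_prod, Real.volume_univ]
  exact ENNReal.top_mul (NeZero.ne _)
end
end

section
/- Let d ≥ 1. There exists a free measure preserving ℤ^d-action T on a σ-finite standard measure space (X, μ) with μ(X) = ∞ such that T is rigid along every line, i.e. 𝓡i(T) = P(ℝ^d). -/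
open MeasureTheory Filter Set Topology

noncomputable section

/-- Translating a measurable set of finite measure by elements tending to `0` moves it by a set
of measure tending to `0`. -/
theorem tendsto_measure_inter_image_add_left {G : Type*} [AddGroup G] [TopologicalSpace G]
    [IsTopologicalAddGroup G] [MeasurableSpace G] [BorelSpace G] (μ : Measure G)
    [μ.IsAddLeftInvariant] [μ.InnerRegularCompactLTTop] [IsLocallyFiniteMeasure μ]
    {ι : Type*} {l : Filter ι} {g : ι → G} (hg : Tendsto g l (𝓝 0))
    {A : Set G} (hA : MeasurableSet A) (hμA : μ A < ⊤) :
    Tendsto (fun n => μ (A ∩ (g n + ·) '' A)) l (𝓝 (μ A)) := by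
  let F : C(G, C(G, G)) := ContinuousMap.curry ⟨fun p : G × G => -p.1 + p.2, by fun_prop⟩
  have hF : Tendsto (fun n => F (g n)) l (𝓝 (F 0)) := (F.continuous.tendsto 0).comp hg
  have hmp : ∀ h, MeasurePreserving (F h) μ μ := fun h => measurePreserving_add_left μ (-h)
  have hsymm := tendsto_measure_symmDiff_preimage_nhds_zero hF
    (.of_forall fun n => hmp (g n)) (hmp 0) hA.nullMeasurableSet hμA.ne
  have hF0 : F 0 ⁻¹' A = A := by
    ext x
    simp [F]
  have himage : ∀ n, (g n + ·) '' A = F (g n) ⁻¹' A := fun n => image_add_left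
  have hlower : Tendsto (fun n => μ A - μ (symmDiff (F (g n) ⁻¹' A) (F 0 ⁻¹' A))) l
      (𝓝 (μ A)) := by
    simpa using ENNReal.Tendsto.sub tendsto_const_nhds hsymm (Or.inl hμA.ne)
  refine tendsto_of_tendsto_of_tendsto_of_le_of_le hlower tendsto_const_nhds (fun n => ?_)
    fun n => measure_mono inter_subset_left
  rw [hF0, himage, tsub_le_iff_right]
  refine (measure_mono fun x hx => ?_).trans (measure_union_le _ _)
  by_cases h : x ∈ F (g n) ⁻¹' A
  · exact Or.inl ⟨hx, h⟩
  · exact Or.inr (Or.inr ⟨hx, h⟩)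

/-- In a first countable compact additive group, some strictly increasing sequence of multiples of
any given element tends to `0`. -/
theorem exists_strictMono_tendsto_nsmul_zero {G : Type*} [AddGroup G] [TopologicalSpace G]
    [IsTopologicalAddGroup G] [CompactSpace G] [FirstCountableTopology G] (x : G) :
    ∃ φ : ℕ → ℕ, StrictMono φ ∧ Tendsto (fun k => φ k • x) atTop (𝓝 0) :=
  (mapClusterPt_zero_atTop_nsmul x).tendsto_subseq

/-- The homomorphism from `ℤ^d` to the `d`-torus sending `γ` to `√2 γ` modulo `1`. -/
def sqrtTwoRotation (d : ℕ) : (Fin d → ℤ) →+ (Fin d → UnitAddCircle) where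
  toFun γ i := ((γ i * √2 : ℝ) : UnitAddCircle)
  map_zero' := by
    ext i
    simp
  map_add' γ γ' := by
    ext i
    simp [add_mul]

theorem sqrtTwoRotation_injective (d : ℕ) : Function.Injective (sqrtTwoRotation d) := by
  rw [injective_iff_map_eq_zero]
  intro γ hγ
  ext i
  by_contra hi
  obtain ⟨n, hn⟩ := (AddCircle.coe_eq_zero_iff (1 : ℝ)).1 (congrFun hγ i)
  refine (irrational_sqrt_two.intCast_mul hi).ne_int n ?_
  simpa using hn.symm

/-- Every line is asymptotic to a sequence in `ℤ^d` along which `sqrtTwoRotation` tends to `0`. -/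
theorem exists_tendsto_sqrtTwoRotation {d : ℕ} {v : Fin d → ℝ} (hv : v ≠ 0) :
    ∃ (φ : ℕ → ℕ) (γ : ℕ → Fin d → ℤ), Tendsto (fun n => ‖zcast (γ n)‖) atTop atTop ∧
      Tendsto (fun n => zcast (γ n) - (φ n : ℝ) • v) atTop (𝓝 0) ∧
      Tendsto (fun n => sqrtTwoRotation d (γ n)) atTop (𝓝 0) := by
  obtain ⟨φ, hφ, hlim⟩ := exists_strictMono_tendsto_nsmul_zero
    ((fun i => (v i : UnitAddCircle), fun i => ((v i * √2 : ℝ) : UnitAddCircle)) :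
      (Fin d → UnitAddCircle) × (Fin d → UnitAddCircle))
  have hfst : ∀ i, Tendsto (fun n => ((φ n * v i : ℝ) : UnitAddCircle)) atTop (𝓝 0) := by
    intro i
    simpa [← nsmul_eq_mul] using tendsto_pi_nhds.1 hlim.fst_nhds i
  have hsnd : ∀ i, Tendsto (fun n => ((φ n * (v i * √2) : ℝ) : UnitAddCircle)) atTop (𝓝 0) := by
    intro i
    simpa only [Prod.smul_snd, Pi.smul_apply, Prod.snd_zero, Pi.zero_apply, ← AddCircle.coe_nsmul,
      nsmul_eq_mul] using tendsto_pi_nhds.1 hlim.snd_nhds i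
  have hround : ∀ i, Tendsto (fun n => (round (φ n * v i) : ℝ) - φ n * v i) atTop (𝓝 0) := by
    intro i
    rw [tendsto_zero_iff_norm_tendsto_zero]
    simpa only [UnitAddCircle.norm_eq, Real.norm_eq_abs, abs_sub_comm, norm_zero]
      using (hfst i).norm
  have hclose : Tendsto (fun n => zcast (fun i => round (φ n * v i)) - (φ n : ℝ) • v) atTop
      (𝓝 0) :=
    tendsto_pi_nhds.2 hround
  refine ⟨φ, fun n i => round (φ n * v i), ?_, hclose, tendsto_pi_nhds.2 fun i => ?_⟩
  · have hnorm : Tendsto (fun n => ‖(φ n : ℝ) • v‖) atTop atTop := by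
      simp only [norm_smul, Real.norm_natCast]
      exact (tendsto_natCast_atTop_atTop.comp hφ.tendsto_atTop).atTop_mul_const
        (norm_pos_iff.2 hv)
    refine tendsto_atTop_mono (fun n => ?_) (hnorm.atTop_add hclose.norm.neg)
    have := norm_sub_norm_le ((φ n : ℝ) • v) (zcast fun i => round (φ n * v i))
    rw [norm_sub_rev] at this
    linarith
  · have hcoe : Tendsto (fun n => ((((round (φ n * v i) : ℝ) - φ n * v i) * √2 : ℝ) :
        UnitAddCircle)) atTop (𝓝 0) := by
      have := ((AddCircle.continuous_mk' (1 : ℝ)).tendsto 0).comp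
        (by simpa using (hround i).mul_const √2)
      rwa [map_zero] at this
    have hadd := hcoe.add (hsnd i)
    rw [add_zero] at hadd
    refine hadd.congr fun n => ?_
    change _ = ((round (φ n * v i) * √2 : ℝ) : UnitAddCircle)
    rw [← AddCircle.coe_add]
    congr 1
    ring

/-- there is a free infinite measure preserving `ℤ^d`-action which is rigid
along every line: `𝓡i(T) = P(ℝ^d)`. -/
theorem exists_action_rigid_in_every_direction {d : ℕ} (hd : 1 ≤ d) :
    ∃ (X : Type) (_ : MeasurableSpace X), StandardBorelSpace X ∧
      ∃ μ : Measure X, SigmaFinite μ ∧ μ Set.univ = ⊤ ∧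
        ∃ T : (Fin d → ℤ) → X ≃ᵐ X, IsMPAction μ T ∧ IsFreeAction μ T ∧
          rigSet μ T = Set.univ := by
  have hcount : IsLocallyFiniteMeasure (Measure.count : Measure ℤ) :=
    ⟨fun n => ⟨{n}, (isOpen_discrete _).mem_nhds rfl, by simp⟩⟩
  have hinv : ((volume : Measure (Fin d → UnitAddCircle)).prod
      (Measure.count : Measure ℤ)).IsAddLeftInvariant :=
    Measure.prod.instIsAddLeftInvariant
  refine ⟨(Fin d → UnitAddCircle) × ℤ, inferInstance, inferInstance,
    (volume : Measure (Fin d → UnitAddCircle)).prod Measure.count, inferInstance, ?_,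
    fun γ => MeasurableEquiv.addLeft (sqrtTwoRotation d γ, (0 : ℤ)), ⟨?_, ?_⟩, ?_, ?_⟩
  · rw [← univ_prod_univ, Measure.prod_prod]
    simp [Measure.count_apply_infinite infinite_univ, ENNReal.mul_top, NeZero.ne]
  · intro γ γ' x
    simp [Prod.ext_iff, add_assoc]
  · exact fun γ => measurePreserving_add_left _ _
  · refine fun γ hγ => .of_forall fun x hx => hγ ?_
    have h := congrArg Prod.fst (add_eq_right.1 hx)
    exact (map_eq_zero_iff _ (sqrtTwoRotation_injective d)).1 h
  · refine eq_univ_of_forall fun θ => ?_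
    obtain ⟨φ, γ, hnorm, hclose, hrot⟩ := exists_tendsto_sqrtTwoRotation θ.rep_nonzero
    refine ⟨γ, hnorm, ?_, fun A hA hμA => ?_⟩
    · refine squeeze_zero (fun _ => Metric.infDist_nonneg) (fun n => ?_)
        (tendsto_zero_iff_norm_tendsto_zero.1 hclose)
      rw [← dist_eq_norm]
      refine Metric.infDist_le_dist_of_mem (Submodule.smul_mem _ _ ?_)
      rw [Projectivization.submodule_eq]
      exact Submodule.mem_span_singleton_self _
    · exact tendsto_measure_inter_image_add_left _
        (hrot.prodMk_nhds tendsto_const_nhds) hA hμA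
end
end

section
/- Let R be an invertible measure preserving transformation of a σ-finite standard measure space (X, μ) that is not conservative. Suppose there is a countable group N of invertible μ-preserving transformations of X that acts ergodically on X and satisfies {S R^n x : n ∈ ℤ} = {R^n S x : n ∈ ℤ} for μ-almost every x ∈ X and every S ∈ N. Then R is totally dissipative: there is a measurable set W ⊆ X such that the sets R^n W, n ∈ ℤ, are pairwise disjoint and μ(X \ ⋃_{n∈ℤ} R^n W) = 0. -/
open MeasureTheory Filter Set

noncomputable section

/-- Integer powers of a measurable equivalence are measurable. -/
theorem MeasurableEquiv.measurable_toEquiv_zpow {X : Type*} [MeasurableSpace X] (R : X ≃ᵐ X)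
    (n : ℤ) : Measurable ⇑(R.toEquiv ^ n) := by
  induction n using Int.induction_on with
  | zero => exact measurable_id
  | succ n ih =>
    rw [zpow_add_one]
    exact ih.comp R.measurable
  | pred n ih =>
    rw [zpow_sub_one]
    exact ih.comp R.symm.measurable

/-- `S` maps the `e`-orbit of `x` onto the `e`-orbit of `S x`. -/
def MapsOrbitOnto {X : Type*} (e : Equiv.Perm X) (S : X → X) (x : X) : Prop :=
  (∀ n : ℤ, ∃ m : ℤ, S ((e ^ n) x) = (e ^ m) (S x)) ∧
    ∀ m : ℤ, ∃ n : ℤ, S ((e ^ n) x) = (e ^ m) (S x)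

namespace MapsOrbitOnto

variable {X : Type*} {e : Equiv.Perm X} {S T : X → X} {x : X}

theorem of_setOf_eq (h : {y : X | ∃ n : ℤ, y = S ((e ^ n) x)} =
    {y : X | ∃ n : ℤ, y = (e ^ n) (S x)}) : MapsOrbitOnto e S x :=
  ⟨fun n => h.subset ⟨n, rfl⟩, fun m => (h.superset ⟨m, rfl⟩).imp fun _ => Eq.symm⟩

theorem zpow_apply (h : MapsOrbitOnto e S x) (k : ℤ) : MapsOrbitOnto e S ((e ^ k) x) := by
  obtain ⟨l, hl⟩ := h.1 k
  constructor
  · intro n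
    obtain ⟨m, hm⟩ := h.1 (n + k)
    refine ⟨m - l, ?_⟩
    rw [hl, ← Equiv.Perm.mul_apply, ← Equiv.Perm.mul_apply, ← zpow_add, ← zpow_add, hm]
    simp
  · intro m
    obtain ⟨n, hn⟩ := h.2 (m + l)
    refine ⟨n - k, ?_⟩
    rw [hl, ← Equiv.Perm.mul_apply, ← Equiv.Perm.mul_apply, ← zpow_add, ← zpow_add, ← hn]
    simp

theorem comp_right (hT : MapsOrbitOnto e T x) (hST : MapsOrbitOnto e (S ∘ T) x) :
    MapsOrbitOnto e S (T x) := by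
  constructor
  · intro n
    obtain ⟨k, hk⟩ := hT.2 n
    rw [← hk]
    exact hST.1 k
  · intro m
    obtain ⟨k, hk⟩ := hST.2 m
    obtain ⟨n, hn⟩ := hT.1 k
    exact ⟨n, by rw [← hn]; exact hk⟩

/-- If `S` maps the orbit of `x` onto a free orbit, then the orbit of `x` is free. -/
theorem zpow_apply_ne (h : MapsOrbitOnto e S x)
    (hfree : ∀ n : ℤ, n ≠ 0 → (e ^ n) (S x) ≠ S x) {n : ℤ} (hn : n ≠ 0) : (e ^ n) x ≠ x := by
  intro hx
  have hfin : (range fun k : ℤ => (e ^ k) (S x)).Finite := by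
    refine ((Set.finite_Ico 0 |n|).image fun k => S ((e ^ k) x)).subset ?_
    rintro _ ⟨m, rfl⟩
    obtain ⟨k, hk⟩ := h.2 m
    refine ⟨k % n, ⟨Int.emod_nonneg k hn, Int.emod_lt_abs k hn⟩, ?_⟩
    have hq : (e ^ (n * (k / n))) x = x := by
      rw [zpow_mul]
      exact Equiv.Perm.zpow_apply_eq_self_of_apply_eq_self hx _
    have hk' : (e ^ k) x = (e ^ (k % n)) x := by
      conv_lhs => rw [← Int.emod_add_mul_ediv k n, zpow_add, Equiv.Perm.mul_apply, hq]
    change S ((e ^ (k % n)) x) = (e ^ m) (S x)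
    rw [← hk', hk]
  refine Set.infinite_range_of_injective (fun a b hab => ?_) hfin
  by_contra hne
  refine hfree (a - b) (sub_ne_zero.2 hne) ?_
  have hab : (e ^ a) (S x) = (e ^ b) (S x) := hab
  rw [sub_eq_neg_add, zpow_add, Equiv.Perm.mul_apply, hab, ← Equiv.Perm.mul_apply, ← zpow_add]
  simp

end MapsOrbitOnto

theorem measurableSet_mapsOrbitOnto {X : Type*} [MeasurableSpace X] [StandardBorelSpace X]
    (R S : X ≃ᵐ X) : MeasurableSet {x | MapsOrbitOnto R.toEquiv S x} := by
  have h (n m : ℤ) : MeasurableSet {x | S ((R.toEquiv ^ n) x) = (R.toEquiv ^ m) (S x)} :=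
    measurableSet_eq_fun (S.measurable.comp (R.measurable_toEquiv_zpow n))
      ((R.measurable_toEquiv_zpow m).comp S.measurable)
  exact (MeasurableSet.iInter fun n => MeasurableSet.iUnion fun m => h n m).inter
    (MeasurableSet.iInter fun m => MeasurableSet.iUnion fun n => h n m) |>.congr
      (by ext; simp [MapsOrbitOnto])

/-- A transformation which is not conservative has a strictly wandering set of positive
measure. -/
theorem exists_wandering_of_not_conservative {X : Type*} [MeasurableSpace X] (μ : Measure X)
    (R : X ≃ᵐ X)
    (hnc : ¬ ∀ B : Set X, MeasurableSet B → 0 < μ B →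
      ∃ n : ℕ, 1 ≤ n ∧ 0 < μ (B ∩ (⇑R)^[n] '' B)) :
    ∃ W : Set X, MeasurableSet W ∧ μ W ≠ 0 ∧
      ∀ x ∈ W, ∀ n : ℤ, n ≠ 0 → (R.toEquiv ^ n) x ∉ W := by
  push Not at hnc
  obtain ⟨B, hB, hpos, hnull⟩ := hnc
  have hcoe (n : ℕ) : (⇑R)^[n] = ⇑(R.toEquiv ^ (n : ℤ)) := by
    rw [zpow_natCast, ← Equiv.Perm.iterate_eq_pow]
    rfl
  have hmeas (n : ℕ) : MeasurableSet ((⇑R)^[n] '' B) := by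
    rw [hcoe, Equiv.image_eq_preimage_symm]
    change MeasurableSet (⇑(R.toEquiv ^ (n : ℤ))⁻¹ ⁻¹' B)
    rw [← zpow_neg]
    exact R.measurable_toEquiv_zpow _ hB
  set U : Set X := ⋃ n : ℕ, (⇑R)^[n + 1] '' B
  have hU : μ (B ∩ U) = 0 := by
    rw [inter_iUnion, measure_iUnion_null_iff]
    exact fun n => le_antisymm (hnull (n + 1) (by omega)) bot_le
  have hpositive (x : X) (hx : x ∈ B \ U) (n : ℕ) :
      (R.toEquiv ^ ((n + 1 : ℕ) : ℤ)) x ∉ B \ U := by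
    rw [← hcoe]
    exact fun h => h.2 (mem_iUnion.2 ⟨n, x, hx.1, rfl⟩)
  refine ⟨B \ U, hB.diff (MeasurableSet.iUnion fun n => hmeas (n + 1)), ?_, ?_⟩
  · intro h
    exact hpos.ne' (measure_mono_null (inter_union_sdiff B U).superset
      (measure_union_null hU h))
  · intro x hx n hn hmem
    rcases lt_or_gt_of_ne hn with h | h
    · obtain ⟨k, rfl⟩ : ∃ k : ℕ, n = -((k + 1 : ℕ) : ℤ) := ⟨(-n - 1).toNat, by omega⟩
      refine hpositive _ hmem k ?_
      rwa [← Equiv.Perm.mul_apply, ← zpow_add, add_neg_cancel, zpow_zero]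
    · obtain ⟨k, rfl⟩ : ∃ k : ℕ, n = ((k + 1 : ℕ) : ℤ) := ⟨(n - 1).toNat, by omega⟩
      exact hpositive x hx k hmem

/-- an invertible measure preserving transformation `R` of a σ-finite standard
measure space which is not conservative, and whose `R`-orbits are permuted by some countable
ergodic group `N` of measure preserving transformations, is totally dissipative. -/
theorem totally_dissipative_of_not_conservative {X : Type*} [MeasurableSpace X]
    [StandardBorelSpace X] (μ : Measure X) [SigmaFinite μ]
    (R : X ≃ᵐ X) (hR : MeasurePreserving R μ μ)
    (hnc : ¬ ∀ B : Set X, MeasurableSet B → 0 < μ B →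
      ∃ n : ℕ, 1 ≤ n ∧ 0 < μ (B ∩ (⇑R)^[n] '' B))
    (N : Set (X ≃ᵐ X)) (hNc : N.Countable)
    (hNmp : ∀ S ∈ N, MeasurePreserving S μ μ)
    (hNone : MeasurableEquiv.refl X ∈ N)
    (hNmul : ∀ S ∈ N, ∀ S' ∈ N, S.trans S' ∈ N)
    (hNinv : ∀ S ∈ N, S.symm ∈ N)
    (hNerg : ∀ A : Set X, MeasurableSet A → (∀ S ∈ N, S '' A = A) → μ A = 0 ∨ μ Aᶜ = 0)
    (hcomm : ∀ S ∈ N, ∀ᵐ x ∂μ,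
      {y : X | ∃ n : ℤ, y = S ((R.toEquiv ^ n) x)} =
        {y : X | ∃ n : ℤ, y = (R.toEquiv ^ n) (S x)}) :
    ∃ W : Set X, MeasurableSet W ∧
      Pairwise (Function.onFun Disjoint fun n : ℤ => ⇑(R.toEquiv ^ n) '' W) ∧
      μ (Set.univ \ ⋃ n : ℤ, ⇑(R.toEquiv ^ n) '' W) = 0 := by
  obtain ⟨W₀, hW₀, hW₀pos, hwand⟩ := exists_wandering_of_not_conservative μ R hnc
  obtain ⟨g, rfl⟩ := hNc.exists_eq_range ⟨_, hNone⟩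
  set E : Set X := {x | ∀ k, MapsOrbitOnto R.toEquiv (g k) x} with hE_def
  have hE : MeasurableSet E := by
    rw [hE_def, ofPred_forall]
    exact MeasurableSet.iInter fun k => measurableSet_mapsOrbitOnto R (g k)
  have hEnull : μ Eᶜ = 0 := by
    have h : ∀ᵐ x ∂μ, ∀ k, MapsOrbitOnto R.toEquiv (g k) x :=
      ae_all_iff.2 fun k => (hcomm (g k) ⟨k, rfl⟩).mono fun x => MapsOrbitOnto.of_setOf_eq
    exact h
  have hER {x : X} (hx : x ∈ E) (n : ℤ) : (R.toEquiv ^ n) x ∈ E := fun k => (hx k).zpow_apply n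
  have hEN {x : X} (hx : x ∈ E) (k : ℕ) : g k x ∈ E := by
    intro l
    obtain ⟨j, hj⟩ := hNmul (g k) ⟨k, rfl⟩ (g l) ⟨l, rfl⟩
    refine (hx k).comp_right ?_
    have := hx j
    rwa [hj, MeasurableEquiv.coe_trans] at this
  set C : ℕ → Set X := fun k => {x | x ∈ E ∧ ∃ n : ℤ, g k ((R.toEquiv ^ n) x) ∈ W₀} with hC_def
  have hC (k : ℕ) : MeasurableSet (C k) := by
    have h : C k = E ∩ ⋃ n : ℤ, (g k ∘ ⇑(R.toEquiv ^ n)) ⁻¹' W₀ := by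
      ext x
      simp [hC_def]
    rw [h]
    exact hE.inter (MeasurableSet.iUnion fun n =>
      ((g k).measurable.comp (R.measurable_toEquiv_zpow n)) hW₀)
  have hCR {x : X} {k : ℕ} (hx : x ∈ C k) (n : ℤ) : (R.toEquiv ^ n) x ∈ C k := by
    obtain ⟨hxE, m, hm⟩ := hx
    refine ⟨hER hxE n, m - n, ?_⟩
    rwa [← Equiv.Perm.mul_apply, ← zpow_add, sub_add_cancel]
  have hCR' {x : X} {k : ℕ} {n : ℤ} (hx : (R.toEquiv ^ n) x ∈ C k) : x ∈ C k := by
    have := hCR hx (-n)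
    rwa [← Equiv.Perm.mul_apply, ← zpow_add, neg_add_cancel, zpow_zero] at this
  have hCmaps {x : X} (hx : x ∈ ⋃ k, C k) (j : ℕ) : g j x ∈ ⋃ k, C k := by
    obtain ⟨k, hxE, n, hn⟩ := mem_iUnion.1 hx
    obtain ⟨m, hm⟩ := (hxE j).1 n
    obtain ⟨l, hl⟩ := hNmul _ (hNinv _ ⟨j, rfl⟩) (g k) ⟨k, rfl⟩
    refine mem_iUnion.2 ⟨l, hEN hxE j, m, ?_⟩
    rw [← hm, hl]
    simpa using hn
  have hconull : μ (⋃ k, C k)ᶜ = 0 := by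
    refine (hNerg _ (MeasurableSet.iUnion hC) ?_).resolve_left ?_
    · rintro _ ⟨j, rfl⟩
      refine Subset.antisymm (image_subset_iff.2 fun x hx => hCmaps hx j) fun x hx => ?_
      obtain ⟨i, hi⟩ := hNinv (g j) ⟨j, rfl⟩
      refine ⟨(g j).symm x, ?_, (g j).apply_symm_apply x⟩
      rw [← hi]
      exact hCmaps hx i
    · intro h
      obtain ⟨i, hi⟩ := hNone
      refine hW₀pos (measure_mono_null (fun x hx => ?_) (measure_union_null h hEnull))
      by_cases hxE : x ∈ E
      · exact Or.inl (mem_iUnion.2 ⟨i, hxE, 0, by simpa [hi] using hx⟩)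
      · exact Or.inr hxE
  set W : Set X := ⋃ k, (E ∩ g k ⁻¹' W₀) \ ⋃ j, ⋃ _ : j < k, C j
  have hW {x : X} (hx : x ∈ W) : ∃ k, x ∈ E ∧ g k x ∈ W₀ ∧ ∀ j < k, x ∉ C j := by
    simpa [W, and_assoc] using hx
  have hWwand {x : X} (hx : x ∈ W) {n : ℤ} (hn : n ≠ 0) : (R.toEquiv ^ n) x ∉ W := by
    intro hy
    obtain ⟨k, hxE, hxk, hxlt⟩ := hW hx
    obtain ⟨l, hyE, hyl, hylt⟩ := hW hy
    have hkl : k = l := by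
      refine le_antisymm (not_lt.1 fun h => hxlt l h ⟨hxE, n, hyl⟩)
        (not_lt.1 fun h => hylt k h (hCR ⟨hxE, 0, hxk⟩ n))
    subst hkl
    obtain ⟨m, hm⟩ := (hxE k).1 n
    rw [hm] at hyl
    obtain rfl : m = 0 := by
      by_contra hm0
      exact hwand _ hxk m hm0 hyl
    exact (hxE k).zpow_apply_ne (fun i hi h => hwand _ hxk i hi (h.symm ▸ hxk)) hn
      ((g k).injective hm)
  refine ⟨W, ?_, ?_, ?_⟩
  · exact MeasurableSet.iUnion fun k => (hE.inter ((g k).measurable hW₀)).diff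
      (MeasurableSet.iUnion fun j => MeasurableSet.iUnion fun _ => hC j)
  · intro a b hab
    refine disjoint_left.2 ?_
    rintro _ ⟨x, hx, rfl⟩ ⟨y, hy, hxy⟩
    refine hWwand hy (sub_ne_zero.2 hab.symm) (n := b - a) ?_
    rw [sub_eq_neg_add, zpow_add, Equiv.Perm.mul_apply, hxy, ← Equiv.Perm.mul_apply, ← zpow_add]
    simpa using hx
  · refine measure_mono_null (t := (⋃ k, C k)ᶜ) (fun x hx hxC => hx.2 ?_) hconull
    classical
    have hex : ∃ k, x ∈ C k := mem_iUnion.1 hxC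
    obtain ⟨hxE, n, hn⟩ := Nat.find_spec hex
    refine mem_iUnion.2 ⟨-n, (R.toEquiv ^ n) x, ?_, ?_⟩
    · refine mem_iUnion.2 ⟨Nat.find hex, ⟨hER hxE n, hn⟩, ?_⟩
      simp only [mem_iUnion, not_exists]
      exact fun j hj h => Nat.find_min hex hj (hCR' h)
    · rw [← Equiv.Perm.mul_apply, ← zpow_add, neg_add_cancel, zpow_zero]
      rfl
end
end
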